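/- Hardy inequality for the MIT bag Dirac operator on a convex cone (Proposition 2.6): Let ω ∈ (0, π/2). Then for every u ∈ dom D_ω one has ∫_{C_ω} |(𝒟u)(x)|² dx ≥ (π/(4ω))² · ∫_{C_ω} |u(x)|² / |x|² dx. -/

import Mathlib

open MeasureTheory Real Set

noncomputable section

/-- The Dirac matrix `α₁`. -/
def alpha1 : Matrix (Fin 4) (Fin 4) ℂ := !![0,0,0,1; 0,0,1,0; 0,1,0,0; 1,0,0,0]

/-- The Dirac matrix `α₂`. -/
def alpha2 : Matrix (Fin 4) (Fin 4) ℂ :=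
  !![0,0,0,-Complex.I; 0,0,Complex.I,0; 0,-Complex.I,0,0; Complex.I,0,0,0]

/-- The Dirac matrix `α₃`. -/
def alpha3 : Matrix (Fin 4) (Fin 4) ℂ := !![0,0,1,0; 0,0,0,-1; 1,0,0,0; 0,-1,0,0]

/-- The Dirac matrix `β`. -/
def betaM : Matrix (Fin 4) (Fin 4) ℂ := !![1,0,0,0; 0,1,0,0; 0,0,-1,0; 0,0,0,-1]

/-- `α · b` for a real vector `b`. -/
def alphaDot (b : Fin 3 → ℝ) : Matrix (Fin 4) (Fin 4) ℂ :=
  (b 0 : ℂ) • alpha1 + (b 1 : ℂ) • alpha2 + (b 2 : ℂ) • alpha3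

/-- The open circular cone of half-aperture `ω`. -/
def Cone (ω : ℝ) : Set (Fin 3 → ℝ) :=
  {x | x 2 > (Real.cos ω / Real.sin ω) * Real.sqrt ((x 0) ^ 2 + (x 1) ^ 2)}

/-- The boundary of the cone of half-aperture `ω`. -/
def ConeBoundary (ω : ℝ) : Set (Fin 3 → ℝ) :=
  {x | x 2 = (Real.cos ω / Real.sin ω) * Real.sqrt ((x 0) ^ 2 + (x 1) ^ 2)}

/-- The outward unit normal on the boundary of the cone. -/
def coneNormal (ω : ℝ) (x : Fin 3 → ℝ) : Fin 3 → ℝ :=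
  ![Real.cos ω * x 0 / Real.sqrt ((x 0) ^ 2 + (x 1) ^ 2),
    Real.cos ω * x 1 / Real.sqrt ((x 0) ^ 2 + (x 1) ^ 2),
    -Real.sin ω]

/-- The free Dirac differential expression `𝒟u = -i (α₁∂₁ + α₂∂₂ + α₃∂₃) u`. -/
def diracOp (u : (Fin 3 → ℝ) → (Fin 4 → ℂ)) (x : Fin 3 → ℝ) : Fin 4 → ℂ :=
  (-Complex.I) • (alpha1.mulVec (fderiv ℝ u x (Pi.single 0 1))
    + alpha2.mulVec (fderiv ℝ u x (Pi.single 1 1))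
    + alpha3.mulVec (fderiv ℝ u x (Pi.single 2 1)))

/-- The domain of the MIT bag Dirac operator on the cone: smooth `ℂ⁴`-valued functions with
compact support in the closed cone minus the tip, satisfying the MIT bag boundary condition. -/
def MITDomain (ω : ℝ) : Set ((Fin 3 → ℝ) → (Fin 4 → ℂ)) :=
  {u | ContDiffOn ℝ (⊤ : ℕ∞) u (closure (Cone ω) \ {0})
    ∧ IsCompact (tsupport u) ∧ tsupport u ⊆ closure (Cone ω) \ {0}
    ∧ ∀ x ∈ ConeBoundary ω, x ≠ 0 →
        u x + Complex.I • betaM.mulVec ((alphaDot (coneNormal ω x)).mulVec (u x)) = 0}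


lemma scalar_ineq (ω : ℝ) (hω : ω ∈ Ioo 0 (π / 2)) :
    (π / (4 * ω)) ^ 2 ≤ (1 + 2 * Real.cos ω) / (4 * Real.sin ω ^ 2) := by
  obtain ⟨h0, h1⟩ := hω
  have hs : 0 < Real.sin ω := Real.sin_pos_of_pos_of_lt_pi h0 (by linarith)
  have hc : 0 < Real.cos ω := Real.cos_pos_of_mem_Ioo ⟨by linarith, h1⟩
  have hsc := Real.sin_sq_add_cos_sq ω
  have p1 := Real.pi_gt_d2
  have p2 := Real.pi_lt_d4
  have key : 0 ≤ 4 * ω ^ 2 * (1 + 2 * Real.cos ω) - π ^ 2 * Real.sin ω ^ 2 := by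
    set c := Real.cos ω with hcdef
    have hs2 : Real.sin ω ^ 2 = 1 - c ^ 2 := by linarith
    rw [hs2]
    obtain ⟨q, hq⟩ : ∃ q, ω = π / 2 * q := ⟨ω / (π / 2), by field_simp⟩
    have hq0 : 0 < q := by
      by_contra h; push Not at h; nlinarith
    have hq1 : q < 1 := by
      by_contra h; push Not at h; nlinarith
    have e : 4 * ω ^ 2 * (1 + 2 * c) - π ^ 2 * (1 - c ^ 2)
        = π ^ 2 * (c ^ 2 + 2 * q ^ 2 * c - 1 + q ^ 2) := by rw [hq]; ring
    rw [e]
    refine mul_nonneg (by positivity) ?_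
    rcases le_or_gt q (7 / 10) with hq2 | hq2
    · have hb : 1 - ω ^ 2 / 2 ≤ c := Real.one_sub_sq_div_two_le_cos
      have hb2 : 1 - 1.24 * q ^ 2 ≤ c := by
        have : ω ^ 2 / 2 ≤ 1.24 * q ^ 2 := by
          rw [hq]
          have : π ^ 2 ≤ 3.1416 ^ 2 := by gcongr
          have e2 : (π / 2 * q) ^ 2 / 2 = π ^ 2 / 8 * q ^ 2 := by ring
          rw [e2]; gcongr; linarith
        linarith
      have hq3 : q ^ 2 ≤ 49 / 100 := by nlinarith
      have hpos : 0 ≤ 1 - 1.24 * q ^ 2 := by linarith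
      have a1 : (1 - 1.24 * q ^ 2) ^ 2 ≤ c ^ 2 := by gcongr
      have a2 : q ^ 2 * (1 - 1.24 * q ^ 2) ≤ q ^ 2 * c := by gcongr
      have a3 : 0 ≤ q ^ 2 * (49 / 100 - q ^ 2) := mul_nonneg (sq_nonneg q) (by linarith)
      have a4 := sq_nonneg q
      clear_value c
      clear e hq hs2 hsc hb h0 h1 p1 p2
      nlinarith
    · set y := 1 - q with hy
      have hq' : q = 1 - y := by linarith
      have hy0 : 0 < y := by linarith
      have hcs : c = Real.sin (π / 2 * y) := by
        rw [hcdef, ← Real.sin_pi_div_two_sub]; congr 1; rw [hq, hy]; ring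
      have h3 := Real.sin_gt_sub_cube (x := π / 2 * y) (by positivity)
      rw [← hcs] at h3
      have h4 : 1.5 * y ≤ c := by
        have : π ^ 3 ≤ 3.1416 ^ 3 := by gcongr
        have h5 : (π / 2 * y) ^ 3 ≤ 4 * y ^ 3 := by
          have : (π / 2 * y) ^ 3 = π ^ 3 / 8 * y ^ 3 := by ring
          rw [this]; gcongr; linarith
        have h6 : y ^ 3 ≤ 9 / 100 * y := by
          have : y ^ 2 ≤ 9 / 100 := by nlinarith
          have e3 : y ^ 3 = y ^ 2 * y := by ring
          rw [e3]; gcongr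
        have h7 : 1.57 * y ≤ π / 2 * y := by gcongr; linarith
        linarith
      have a1 : (1.5 * y) ^ 2 ≤ c ^ 2 := by gcongr
      have a2 : q ^ 2 * (1.5 * y) ≤ q ^ 2 * c := by gcongr
      have a3 : 0 ≤ y * (3 / 10 - y) := mul_nonneg hy0.le (by linarith)
      have a4 := pow_pos hy0 3
      clear_value c y
      clear e hq hs2 hsc h0 h1 p1 p2 hcs h3
      subst hq'
      nlinarith
  rw [div_pow, div_le_div_iff₀ (by positivity) (by positivity)]
  nlinarith

lemma cone_isOpen (ω : ℝ) : IsOpen (Cone ω) := by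
  unfold Cone
  exact isOpen_lt (by fun_prop) (by fun_prop)

/-- vertical distance to the boundary of the cone -/
def dv (ω : ℝ) (x : Fin 3 → ℝ) : ℝ :=
  x 2 - (Real.cos ω / Real.sin ω) * Real.sqrt ((x 0) ^ 2 + (x 1) ^ 2)

lemma dv_cont (ω : ℝ) : Continuous (dv ω) := by unfold dv; fun_prop

lemma mem_cone_iff (ω : ℝ) (x) : x ∈ Cone ω ↔ 0 < dv ω x := by
  simp [Cone, dv]

lemma mem_closure_iff' (ω : ℝ) (x) : x ∈ closure (Cone ω) ↔ 0 ≤ dv ω x := by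
  constructor
  · intro h
    have hc : IsClosed {x | 0 ≤ dv ω x} := isClosed_le continuous_const (dv_cont ω)
    exact closure_minimal (fun y hy => ((mem_cone_iff ω y).1 hy).le) hc h
  · intro h
    have ht : Filter.Tendsto (fun t : ℝ => x + t • (Pi.single 2 1 : Fin 3 → ℝ))
        (nhdsWithin 0 (Ioi 0)) (nhds x) := by
      have : Continuous (fun t : ℝ => x + t • (Pi.single 2 1 : Fin 3 → ℝ)) := by fun_prop
      have := this.tendsto 0
      simp only [zero_smul, add_zero] at this
      exact this.mono_left nhdsWithin_le_nhds
    refine mem_closure_of_tendsto ht ?_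
    filter_upwards [self_mem_nhdsWithin] with t ht
    rw [mem_cone_iff]
    simp only [dv, Pi.add_apply, Pi.smul_apply, Pi.single_apply, smul_eq_mul] at h ⊢
    simp
    simp at ht
    linarith

/-- closed cone without the tip -/
abbrev SS (ω : ℝ) : Set (Fin 3 → ℝ) := closure (Cone ω) \ {0}

lemma cone_sub_SS (ω : ℝ) : Cone ω ⊆ SS ω := by
  intro x hx
  refine ⟨subset_closure hx, ?_⟩
  rintro rfl
  simp [Cone] at hx

lemma SS_nhds (ω : ℝ) {x} (hx : x ∈ Cone ω) : SS ω ∈ nhds x :=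
  Filter.mem_of_superset ((cone_isOpen ω).mem_nhds hx) (cone_sub_SS ω)

lemma cone_convex (ω : ℝ) (hω : ω ∈ Ioo 0 (π / 2)) : Convex ℝ (Cone ω) := by
  obtain ⟨h0, h1⟩ := hω
  have hs : 0 < Real.sin ω := Real.sin_pos_of_pos_of_lt_pi h0 (by linarith [pi_pos])
  have hc : 0 < Real.cos ω := Real.cos_pos_of_mem_Ioo ⟨by linarith, h1⟩
  have hq : 0 < Real.cos ω / Real.sin ω := by positivity
  have hn : ∀ x : Fin 3 → ℝ, Real.sqrt ((x 0) ^ 2 + (x 1) ^ 2) = ‖(⟨x 0, x 1⟩ : ℂ)‖ := by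
    intro x; rw [Complex.norm_def, Complex.normSq_mk]; congr 1; ring
  intro x hx y hy a b ha hb hab
  simp only [Cone, mem_ofPred_eq, hn, gt_iff_lt] at *
  have : (⟨(a • x + b • y) 0, (a • x + b • y) 1⟩ : ℂ) = a • ⟨x 0, x 1⟩ + b • ⟨y 0, y 1⟩ := by
    apply Complex.ext <;> simp
  rw [this]
  have h3 := norm_add_le (a • (⟨x 0, x 1⟩ : ℂ)) (b • ⟨y 0, y 1⟩)
  rw [norm_smul, norm_smul, Real.norm_of_nonneg ha, Real.norm_of_nonneg hb] at h3
  simp only [Pi.add_apply, Pi.smul_apply, smul_eq_mul]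
  generalize ‖(⟨x 0, x 1⟩ : ℂ)‖ = X at *
  generalize ‖(⟨y 0, y 1⟩ : ℂ)‖ = Y at *
  generalize Real.cos ω / Real.sin ω = q at *
  have h4 := mul_le_mul_of_nonneg_left h3 hq.le
  refine h4.trans_lt ?_
  rcases ha.eq_or_lt with rfl | ha'
  · have : b = 1 := by linarith
    subst this; linarith
  · nlinarith [mul_lt_mul_of_pos_left hx ha', mul_le_mul_of_nonneg_left hy.le hb]

lemma SS_uniqueDiff (ω : ℝ) (hω : ω ∈ Ioo 0 (π / 2)) : UniqueDiffOn ℝ (SS ω) := by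
  have h := uniqueDiffOn_convex (cone_convex ω hω).closure ?_
  · exact h.inter isOpen_compl_singleton
  · refine ⟨Pi.single 2 1, ?_⟩
    apply interior_mono subset_closure
    rw [(cone_isOpen ω).interior_eq]
    simp [Cone]


lemma exists_eta : ∃ (η : ℝ → ℝ) (M : ℝ), ContDiff ℝ 1 η ∧ (∀ t ≤ 1/2, η t = 0) ∧
    (∀ t, 1 ≤ t → η t = 1) ∧ (∀ t, |η t| ≤ 1) ∧ 0 ≤ M ∧ ∀ t, |deriv η t| ≤ M := by
  let η : ℝ → ℝ := fun t => Real.smoothTransition (2 * t - 1)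
  have hη : ContDiff ℝ 1 η := Real.smoothTransition.contDiff.comp (by fun_prop)
  have h0 : ∀ t ≤ 1/2, η t = 0 := fun t ht =>
    Real.smoothTransition.zero_of_nonpos (by linarith)
  have h1 : ∀ t, 1 ≤ t → η t = 1 := fun t ht =>
    Real.smoothTransition.one_of_one_le (by linarith)
  obtain ⟨M, hM⟩ := (isCompact_Icc (a := (0:ℝ)) (b := 2)).exists_bound_of_continuousOn
    (hη.continuous_deriv le_rfl).continuousOn
  refine ⟨η, max M 0, hη, h0, h1, ?_, le_max_right _ _, ?_⟩
  · intro t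
    rw [abs_of_nonneg (Real.smoothTransition.nonneg _)]
    exact Real.smoothTransition.le_one _
  · intro t
    by_cases ht : t ∈ Icc (0:ℝ) 2
    · exact (hM t ht).trans (le_max_left _ _)
    · have : deriv η t = 0 := by
        rw [mem_Icc, not_and_or] at ht
        push Not at ht
        rcases ht with ht | ht
        · have : η =ᶠ[nhds t] fun _ => 0 := by
            filter_upwards [Iio_mem_nhds ht] with s hs
            exact h0 s (by simp at hs; linarith)
          rw [this.deriv_eq]; simp
        · have : η =ᶠ[nhds t] fun _ => 1 := by
            filter_upwards [Ioi_mem_nhds ht] with s hs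
            exact h1 s (by simp at hs; linarith)
          rw [this.deriv_eq]; simp
      rw [this]; simp

lemma dv_hasFDerivAt (ω : ℝ) (hs : 0 < Real.sin ω) (x : Fin 3 → ℝ)
    (hx : 0 < x 0 ^ 2 + x 1 ^ 2) :
    ∃ D : (Fin 3 → ℝ) →L[ℝ] ℝ, HasFDerivAt (dv ω) D x ∧
      ∀ j, D (Pi.single j 1) = - coneNormal ω x j / Real.sin ω := by
  have hp : ∀ j : Fin 3, HasFDerivAt (fun y : Fin 3 → ℝ => y j)
      (ContinuousLinearMap.proj (R := ℝ) (φ := fun _ : Fin 3 => ℝ) j) x := fun j =>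
    hasFDerivAt_apply j x
  have h := (hp 2).sub (((((hp 0).pow 2).add ((hp 1).pow 2)).sqrt hx.ne').const_mul
    (Real.cos ω / Real.sin ω))
  refine ⟨_, h, ?_⟩
  have hr : 0 < Real.sqrt (x 0 ^ 2 + x 1 ^ 2) := Real.sqrt_pos.2 hx
  intro j
  fin_cases j <;> simp [coneNormal] <;> field_simp

lemma dv_contDiffAt (ω : ℝ) (x : Fin 3 → ℝ)
    (hx : 0 < x 0 ^ 2 + x 1 ^ 2) : ContDiffAt ℝ 1 (dv ω) x := by
  unfold dv
  refine ContDiffAt.sub (by fun_prop) (contDiffAt_const.mul (ContDiffAt.sqrt (by fun_prop) hx.ne'))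

lemma coneNormal_abs (ω : ℝ) (x : Fin 3 → ℝ) (j) : |coneNormal ω x j| ≤ 1 := by
  have key : ∀ (a b : ℝ), |Real.cos ω * a / Real.sqrt (a ^ 2 + b ^ 2)| ≤ 1 := by
    intro a b
    rw [mul_div_assoc, abs_mul]
    have h1 := Real.abs_cos_le_one ω
    have h2 : |a / Real.sqrt (a ^ 2 + b ^ 2)| ≤ 1 := by
      rw [abs_div, abs_of_nonneg (Real.sqrt_nonneg _)]
      apply div_le_one_of_le₀ _ (Real.sqrt_nonneg _)
      apply Real.abs_le_sqrt; nlinarith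
    exact mul_le_one₀ h1 (abs_nonneg _) h2
  fin_cases j
  · simpa [coneNormal] using key (x 0) (x 1)
  · have := key (x 1) (x 0)
    rw [add_comm] at this
    simpa [coneNormal] using this
  · simpa [coneNormal] using Real.abs_sin_le_one ω

lemma sum_abs_le (f : Fin 3 → ℝ) (M : ℝ) (h : ∀ j, |f j| ≤ M) : |∑ j, f j| ≤ 3 * M := by
  refine (Finset.abs_sum_le_sum_abs _ _).trans ?_
  refine (Finset.sum_le_sum (fun j _ => h j)).trans ?_
  simp

lemma single_norm (j : Fin 3) : ‖(Pi.single j 1 : Fin 3 → ℝ)‖ = 1 := by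
  simp [Pi.norm_single]

lemma fderiv_bound (ω : ℝ) (hω : ω ∈ Ioo 0 (π / 2)) (F : Fin 3 → (Fin 3 → ℝ) → ℝ)
    (hF : ∀ j, ContDiffOn ℝ 1 (F j) (SS ω)) (K : Set (Fin 3 → ℝ)) (hK : IsCompact K)
    (hKS : K ⊆ SS ω) (hF0 : ∀ j, ∀ x ∉ K, F j x = 0) :
     ∃ M : ℝ, 0 ≤ M ∧ ∀ j, ∀ x ∈ SS ω, ‖fderivWithin ℝ (F j) (SS ω) x‖ ≤ M := by
  have hc : ∀ j, ContinuousOn (fderivWithin ℝ (F j) (SS ω)) K := fun j =>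
    ((hF j).continuousOn_fderivWithin (SS_uniqueDiff ω hω) le_rfl).mono hKS
  choose M hM using fun j => hK.exists_bound_of_continuousOn (hc j)
  refine ⟨∑ j, |M j|, Finset.sum_nonneg fun j _ => abs_nonneg _, fun j x hx => ?_⟩
  by_cases h : x ∈ K
  · exact ((hM j x h).trans (le_abs_self _)).trans
      (Finset.single_le_sum (f := fun j => |M j|) (fun j _ => abs_nonneg _) (Finset.mem_univ j))
  · have : F j =ᶠ[nhds x] fun _ => 0 := by
      filter_upwards [hK.isClosed.isOpen_compl.mem_nhds h] with y hy
      exact hF0 j y hy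
    have h2 : HasFDerivAt (𝕜 := ℝ) (F j) 0 x := (hasFDerivAt_const (𝕜 := ℝ) (0:ℝ) x).congr_of_eventuallyEq this
    rw [h2.hasFDerivWithinAt.fderivWithin (SS_uniqueDiff ω hω x hx)]
    simp; exact Finset.sum_nonneg fun j _ => abs_nonneg _

lemma flux_bound (ω : ℝ) (F : Fin 3 → (Fin 3 → ℝ) → ℝ)
    (hF : ∀ j, ContDiffOn ℝ 1 (F j) (SS ω))
    (hflux : ∀ x ∈ ConeBoundary ω, x ≠ 0 → ∑ j, F j x * coneNormal ω x j = 0)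
    (M : ℝ) (hM0 : 0 ≤ M) (hM : ∀ j, ∀ x ∈ SS ω, ‖fderivWithin ℝ (F j) (SS ω) x‖ ≤ M)
    (x : Fin 3 → ℝ) (hx : x ∈ Cone ω) (hr : 0 < x 0 ^ 2 + x 1 ^ 2) :
    |∑ j, F j x * coneNormal ω x j| ≤ 3 * M * dv ω x := by
  set y : ℝ → (Fin 3 → ℝ) := fun t => x + (t - dv ω x) • (Pi.single 2 1 : Fin 3 → ℝ) with hy
  have hd := (mem_cone_iff ω x).1 hx
  have y0 : ∀ t, y t 0 = x 0 := by intro t; simp [hy]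
  have y1 : ∀ t, y t 1 = x 1 := by intro t; simp [hy]
  have y2 : ∀ t, y t 2 = x 2 + (t - dv ω x) := by intro t; simp [hy]
  have hdy : ∀ t, dv ω (y t) = t := by
    intro t
    conv_lhs => rw [dv, y0, y1, y2]
    rw [dv]; ring
  have hny : ∀ t, coneNormal ω (y t) = coneNormal ω x := by
    intro t; simp only [coneNormal, y0, y1]
  have hne : ∀ t, y t ≠ 0 := by
    intro t h
    have a0 := y0 t; have a1 := y1 t
    rw [h] at a0 a1
    simp at a0 a1
    rw [← a0, ← a1] at hr; simp at hr
  have hmem : MapsTo y (Icc 0 (dv ω x)) (SS ω) := by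
    intro t ht
    refine ⟨(mem_closure_iff' ω _).2 ?_, hne t⟩
    rw [hdy]; exact ht.1
  have hyd : ∀ t, HasDerivAt y (Pi.single 2 1) t := by
    intro t
    have := (((hasDerivAt_id t).sub_const (dv ω x)).smul_const
      (Pi.single 2 1 : Fin 3 → ℝ)).const_add x
    rw [one_smul] at this
    exact this
  have hder : ∀ t ∈ Icc 0 (dv ω x), HasDerivWithinAt
      (fun t => ∑ j, F j (y t) * coneNormal ω x j)
      (∑ j, fderivWithin ℝ (F j) (SS ω) (y t) (Pi.single 2 1) * coneNormal ω x j)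
      (Icc 0 (dv ω x)) t := by
    intro t ht
    refine HasDerivWithinAt.fun_sum fun j _ => ?_
    refine HasDerivWithinAt.mul_const ?_ _
    have h1 := ((hF j).differentiableOn (by simp) (y t) (hmem ht)).hasFDerivWithinAt
    exact h1.comp_hasDerivWithinAt t (hyd t).hasDerivWithinAt hmem
  have hb := (convex_Icc 0 (dv ω x)).norm_image_sub_le_of_norm_hasDerivWithin_le hder
    (C := 3 * M) ?_ (left_mem_Icc.2 hd.le) (right_mem_Icc.2 hd.le)
  · have e0 : ∑ j, F j (y 0) * coneNormal ω x j = 0 := by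
      rw [← hny 0]
      refine hflux _ ?_ (hne 0)
      have := hdy 0
      rw [dv] at this
      simp only [ConeBoundary, mem_ofPred_eq]; linarith
    have e1 : y (dv ω x) = x := by simp [hy]
    simp only [e1] at hb
    rw [e0] at hb
    simpa [abs_of_pos hd] using hb
  · intro t ht
    rw [Real.norm_eq_abs]
    refine sum_abs_le _ _ fun j => ?_
    rw [abs_mul]
    have h2 : |fderivWithin ℝ (F j) (SS ω) (y t) (Pi.single 2 1)| ≤ M := by
      have := (fderivWithin ℝ (F j) (SS ω) (y t)).le_opNorm (Pi.single 2 1)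
      rw [single_norm, mul_one] at this
      exact this.trans (hM j _ (hmem ht))
    have h3 := coneNormal_abs ω x j
    calc _ ≤ M * 1 := by gcongr
      _ = M := mul_one M

lemma G_contDiff (ω : ℝ) (F : Fin 3 → (Fin 3 → ℝ) → ℝ)
    (hF : ∀ j, ContDiffOn ℝ 1 (F j) (SS ω)) (K : Set (Fin 3 → ℝ)) (hK : IsCompact K)
    (hF0 : ∀ j, ∀ x ∉ K, F j x = 0)
    (η : ℝ → ℝ) (hη : ContDiff ℝ 1 η) (h0 : ∀ t ≤ 1/2, η t = 0)
    (h1 : ∀ t, 1 ≤ t → η t = 1) (r ε : ℝ) (hr : ∀ x ∈ K, r ≤ ‖x‖) (hε : 0 < ε) (hεr : ε < r)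
    (j : Fin 3) : ContDiff ℝ 1 (fun x => η (dv ω x / ε) * F j x) := by
  rw [contDiff_iff_contDiffAt]
  intro x
  have hzero : (fun x => η (dv ω x / ε) * F j x) =ᶠ[nhds x] (fun _ => 0) →
      ContDiffAt ℝ 1 (fun x => η (dv ω x / ε) * F j x) x := fun h =>
    contDiffAt_const.congr_of_eventuallyEq h
  by_cases hx : x ∈ K
  swap
  · apply hzero
    filter_upwards [hK.isClosed.isOpen_compl.mem_nhds hx] with y hy
    rw [hF0 j y hy, mul_zero]
  by_cases hd : dv ω x < ε / 2
  · apply hzero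
    filter_upwards [(dv_cont ω).continuousAt.preimage_mem_nhds (Iio_mem_nhds hd)] with y hy
    rw [h0, zero_mul]
    rw [div_le_iff₀ hε]; simp at hy; linarith
  push Not at hd
  have hxc : x ∈ Cone ω := (mem_cone_iff ω x).2 (by linarith)
  have hFx : ContDiffAt ℝ 1 (F j) x := (hF j).contDiffAt (SS_nhds ω hxc)
  by_cases hd2 : ε < dv ω x
  · refine hFx.congr_of_eventuallyEq ?_
    filter_upwards [(dv_cont ω).continuousAt.preimage_mem_nhds (Ioi_mem_nhds hd2)] with y hy
    rw [h1, one_mul]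
    rw [le_div_iff₀ hε]; simp at hy; linarith
  push Not at hd2
  have hρ : 0 < x 0 ^ 2 + x 1 ^ 2 := by
    by_contra hcon
    have e0 : x 0 = 0 := by nlinarith [sq_nonneg (x 0), sq_nonneg (x 1)]
    have e1 : x 1 = 0 := by nlinarith [sq_nonneg (x 0), sq_nonneg (x 1)]
    have e2 : dv ω x = x 2 := by simp [dv, e0, e1]
    have : ‖x‖ ≤ ε := by
      rw [pi_norm_le_iff_of_nonneg hε.le]
      intro i
      fin_cases i
      · simp [e0, hε.le]
      · simp [e1, hε.le]
      · simp [abs_le]; constructor <;> linarith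
    linarith [hr x hx]
  exact (hη.contDiffAt.comp x ((dv_contDiffAt ω x hρ).div_const ε)).mul hFx



lemma integral_fderiv_zero (G : (Fin 3 → ℝ) → ℝ) (hG : ContDiff ℝ 1 G)
    (hs : HasCompactSupport G) (v : Fin 3 → ℝ) :
    Integrable (fun x => fderiv ℝ G x v) ∧ ∫ x, fderiv ℝ G x v = 0 := by
  have hc : Continuous (fun x => fderiv ℝ G x v) := by
    have := hG.continuous_fderiv one_ne_zero
    fun_prop
  have hi : Integrable (fun x => fderiv ℝ G x v) :=
    hc.integrable_of_hasCompactSupport (hs.fderiv_apply (𝕜 := ℝ) v)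
  refine ⟨hi, ?_⟩
  have := integral_mul_fderiv_eq_neg_fderiv_mul_of_integrable (μ := volume) (𝕜 := ℝ)
    (f := fun _ : Fin 3 → ℝ => (1:ℝ)) (g := G) (v := v) (by simp)
    (by simpa using hi) (by simpa using hG.continuous.integrable_of_hasCompactSupport hs)
    (fun x _ => by fun_prop) (fun x _ => hG.differentiable (by simp) x)
  simpa using this

lemma div_zero_flux (ω : ℝ) (hω : ω ∈ Ioo 0 (π / 2)) (F : Fin 3 → (Fin 3 → ℝ) → ℝ)
    (hF : ∀ j, ContDiffOn ℝ 1 (F j) (SS ω)) (K : Set (Fin 3 → ℝ)) (hK : IsCompact K)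
    (hKS : K ⊆ SS ω) (hF0 : ∀ j, ∀ x ∉ K, F j x = 0)
    (hflux : ∀ x ∈ ConeBoundary ω, x ≠ 0 → ∑ j, F j x * coneNormal ω x j = 0) :
    ∫ x in Cone ω, ∑ j, fderiv ℝ (F j) x (Pi.single j 1) = 0 := by
  have hs : 0 < Real.sin ω := Real.sin_pos_of_pos_of_lt_pi hω.1 (by linarith [hω.2, pi_pos])
  obtain ⟨η, N, hη, h0, h1, hη1, hN0, hN⟩ := exists_eta
  obtain ⟨M, hM0, hM⟩ := fderiv_bound ω hω F hF K hK hKS hF0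
  obtain ⟨r, hr0, hr⟩ : ∃ r > 0, ∀ x ∈ K, r ≤ ‖x‖ := by
    have : (0 : Fin 3 → ℝ) ∈ Kᶜ := fun h => (hKS h).2 rfl
    obtain ⟨r, hr0, hr⟩ := Metric.isOpen_iff.1 hK.isClosed.isOpen_compl 0 this
    refine ⟨r, hr0, fun x hx => ?_⟩
    by_contra hcon
    push Not at hcon
    exact hr (by simpa using hcon) hx
  set G : ℝ → Fin 3 → (Fin 3 → ℝ) → ℝ := fun ε j x => η (dv ω x / ε) * F j x with hGdef
  have hG : ∀ ε, 0 < ε → ε < r → ∀ j, ContDiff ℝ 1 (G ε j) := fun ε hε hεr j =>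
    G_contDiff ω F hF K hK hF0 η hη h0 h1 r ε hr hε hεr j
  have hGK : ∀ ε j, ∀ x ∉ K, G ε j x = 0 := fun ε j x hx => by
    simp only [hGdef]; rw [hF0 j x hx, mul_zero]
  have hGs : ∀ ε j, HasCompactSupport (G ε j) := fun ε j =>
    HasCompactSupport.intro hK (hGK ε j)
  have hGK' : ∀ ε j, ∀ x ∉ K, fderiv ℝ (G ε j) x = 0 := fun ε j x hx => by
    have : G ε j =ᶠ[nhds x] fun _ => 0 := by
      filter_upwards [hK.isClosed.isOpen_compl.mem_nhds hx] with y hy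
      exact hGK ε j y hy
    rw [this.fderiv_eq]; simp
  have hGC : ∀ ε, 0 < ε → ∀ j, ∀ x ∉ Cone ω, fderiv ℝ (G ε j) x = 0 := fun ε hε j x hx => by
    rw [mem_cone_iff, not_lt] at hx
    have hx' : dv ω x < ε / 2 := by linarith
    have : G ε j =ᶠ[nhds x] fun _ => 0 := by
      filter_upwards [(dv_cont ω).continuousAt.preimage_mem_nhds (Iio_mem_nhds hx')] with y hy
      simp only [hGdef]
      rw [h0, zero_mul]
      rw [div_le_iff₀ hε]; simp at hy; linarith
    rw [this.fderiv_eq]; simp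
  have hGF : ∀ ε, 0 < ε → ∀ j, ∀ x, ε < dv ω x → fderiv ℝ (G ε j) x = fderiv ℝ (F j) x :=
    fun ε hε j x hx => by
    have : G ε j =ᶠ[nhds x] F j := by
      filter_upwards [(dv_cont ω).continuousAt.preimage_mem_nhds (Ioi_mem_nhds hx)] with y hy
      simp only [hGdef]
      rw [h1, one_mul]
      rw [le_div_iff₀ hε]; simp at hy; linarith
    rw [this.fderiv_eq]
  have hFd : ∀ j, ∀ x ∈ Cone ω, |fderiv ℝ (F j) x (Pi.single j 1)| ≤ M := fun j x hx => by
    rw [← fderivWithin_of_mem_nhds (SS_nhds ω hx)]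
    have := (fderivWithin ℝ (F j) (SS ω) x).le_opNorm (Pi.single j 1)
    rw [single_norm, mul_one] at this
    exact this.trans (hM j _ (cone_sub_SS ω hx))
  set C := 3 * M + N * (3 * M) / Real.sin ω with hC
  have hC0 : 0 ≤ N * (3 * M) / Real.sin ω := by positivity
  have hbound : ∀ ε, 0 < ε → ε < r → ∀ x ∈ Cone ω,
      ‖∑ j, fderiv ℝ (G ε j) x (Pi.single j 1)‖ ≤ K.indicator (fun _ => C) x := by
    intro ε hε hεr x hx
    by_cases hxK : x ∈ K
    swap
    · simp [hxK, hGK' _ _ x hxK]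
    rw [indicator_of_mem hxK, Real.norm_eq_abs]
    by_cases hd : ε < dv ω x
    · have h3 := sum_abs_le _ M (fun j => hFd j x hx)
      simp only [hGF ε hε _ x hd]
      linarith
    push Not at hd
    have hρ : 0 < x 0 ^ 2 + x 1 ^ 2 := by
      by_contra hcon
      have e0 : x 0 = 0 := by nlinarith [sq_nonneg (x 0), sq_nonneg (x 1)]
      have e1 : x 1 = 0 := by nlinarith [sq_nonneg (x 0), sq_nonneg (x 1)]
      have e2 : dv ω x = x 2 := by simp [dv, e0, e1]
      have e3 := (mem_cone_iff ω x).1 hx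
      have : ‖x‖ ≤ ε := by
        rw [pi_norm_le_iff_of_nonneg hε.le]
        intro i
        fin_cases i
        · simp [e0, hε.le]
        · simp [e1, hε.le]
        · simp [abs_le]; constructor <;> linarith
      linarith [hr x hxK]
    obtain ⟨D, hD, hDj⟩ := dv_hasFDerivAt ω hs x hρ
    have hd0 := (mem_cone_iff ω x).1 hx
    have hfl := flux_bound ω F hF hflux M hM0 hM x hx hρ
    have hder : ∀ j, fderiv ℝ (G ε j) x (Pi.single j 1) =
        η (dv ω x / ε) * fderiv ℝ (F j) x (Pi.single j 1)
          + (- (deriv η (dv ω x / ε) / ε / Real.sin ω)) * (F j x * coneNormal ω x j) := by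
      intro j
      have hFj : HasFDerivAt (F j) (fderiv ℝ (F j) x) x :=
        (((hF j).contDiffAt (SS_nhds ω hx)).differentiableAt (by simp)).hasFDerivAt
      have hη' : HasDerivAt η (deriv η (dv ω x / ε)) (dv ω x / ε) :=
        (hη.differentiable (by simp) _).hasDerivAt
      have h2 : HasFDerivAt (fun y => dv ω y / ε) (ε⁻¹ • D) x := by
        simpa only [div_eq_inv_mul] using hD.const_mul ε⁻¹
      have h3 := (hη'.comp_hasFDerivAt x h2).mul hFj
      have h4 : fderiv ℝ (G ε j) x = _ := h3.fderiv
      rw [h4]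
      simp [hDj]
      field_simp
    simp only [hder]
    rw [Finset.sum_add_distrib, ← Finset.mul_sum, ← Finset.mul_sum]
    refine (abs_add_le _ _).trans ?_
    rw [hC]
    gcongr
    · rw [abs_mul]
      have h3 := sum_abs_le _ M (fun j => hFd j x hx)
      calc _ ≤ 1 * (3 * M) := by gcongr; exact hη1 _
        _ = _ := one_mul _
    · rw [abs_mul, abs_neg, abs_div, abs_div, abs_of_pos hε, abs_of_pos hs]
      calc _ ≤ N / ε / Real.sin ω * (3 * M * ε) := by
            gcongr
            · exact hN _
            · exact hfl.trans (by gcongr)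
        _ = _ := by field_simp
  have hint : ∀ ε, 0 < ε → ε < r →
      ∫ x in Cone ω, ∑ j, fderiv ℝ (G ε j) x (Pi.single j 1) = 0 := by
    intro ε hε hεr
    rw [setIntegral_eq_integral_of_forall_compl_eq_zero
      (fun x hx => by simp [hGC ε hε _ x hx])]
    rw [integral_finsetSum _ (fun j _ =>
      (integral_fderiv_zero _ (hG ε hε hεr j) (hGs ε j) _).1)]
    exact Finset.sum_eq_zero fun j _ =>
      (integral_fderiv_zero _ (hG ε hε hεr j) (hGs ε j) _).2
  have hev : ∀ᶠ ε in nhdsWithin (0:ℝ) (Ioi 0), 0 < ε ∧ ε < r := by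
    have := Ioo_mem_nhdsGT hr0
    filter_upwards [this] with ε h using ⟨h.1, h.2⟩
  have hlim : Filter.Tendsto
      (fun ε => ∫ x in Cone ω, ∑ j, fderiv ℝ (G ε j) x (Pi.single j 1))
      (nhdsWithin (0:ℝ) (Ioi 0))
      (nhds (∫ x in Cone ω, ∑ j, fderiv ℝ (F j) x (Pi.single j 1))) := by
    refine tendsto_integral_filter_of_dominated_convergence (K.indicator (fun _ => C)) ?_ ?_ ?_ ?_
    · filter_upwards [hev] with ε hε
      have hc : Continuous fun x => ∑ j, fderiv ℝ (G ε j) x (Pi.single j 1) := by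
        refine continuous_finsetSum _ fun j _ => ?_
        have := (hG ε hε.1 hε.2 j).continuous_fderiv one_ne_zero
        fun_prop
      exact hc.aestronglyMeasurable
    · filter_upwards [hev] with ε hε
      filter_upwards [ae_restrict_mem (cone_isOpen ω).measurableSet] with x hx
      exact hbound ε hε.1 hε.2 x hx
    · apply Integrable.restrict
      rw [integrable_indicator_iff hK.measurableSet]
      exact integrableOn_const hK.measure_lt_top.ne
    · filter_upwards [ae_restrict_mem (cone_isOpen ω).measurableSet] with x hx
      refine tendsto_const_nhds.congr' ?_
      have hd0 := (mem_cone_iff ω x).1 hx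
      filter_upwards [Ioo_mem_nhdsGT hd0] with ε hε
      simp only [hGF ε hε.1 _ x hε.2]
  have hz : Filter.Tendsto
      (fun ε => ∫ x in Cone ω, ∑ j, fderiv ℝ (G ε j) x (Pi.single j 1))
      (nhdsWithin (0:ℝ) (Ioi 0)) (nhds 0) := by
    refine tendsto_const_nhds.congr' ?_
    filter_upwards [hev] with ε hε
    exact (hint ε hε.1 hε.2).symm
  exact tendsto_nhds_unique hlim hz


/-- spinor space -/
abbrev Sp := Fin 4 → ℂ

def A12 : Matrix (Fin 4) (Fin 4) ℂ :=
  !![Complex.I,0,0,0; 0,-Complex.I,0,0; 0,0,Complex.I,0; 0,0,0,-Complex.I]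
def A13 : Matrix (Fin 4) (Fin 4) ℂ := !![0,-1,0,0; 1,0,0,0; 0,0,0,-1; 0,0,1,0]
def A23 : Matrix (Fin 4) (Fin 4) ℂ :=
  !![0,Complex.I,0,0; Complex.I,0,0,0; 0,0,0,Complex.I; 0,0,Complex.I,0]

/-- the real bilinear form `Re ⟨a, A b⟩` -/
def PB (A : Matrix (Fin 4) (Fin 4) ℂ) : Sp →L[ℝ] Sp →L[ℝ] ℝ :=
  (LinearMap.mk₂ ℝ (fun a b : Sp => (star a ⬝ᵥ A.mulVec b).re)
    (by intro a b c; simp [star_add, add_dotProduct])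
    (by intro t a b; simp [star_smul, smul_dotProduct])
    (by intro a b c; simp [Matrix.mulVec_add, dotProduct_add])
    (by intro t a b; simp [Matrix.mulVec_smul, dotProduct_smul])).toContinuousBilinearMap

lemma PB_apply (A) (a b : Sp) : PB A a b = (star a ⬝ᵥ A.mulVec b).re := rfl

def jj (a b : ℂ) : ℝ := a.im * b.re - a.re * b.im
def rrp (a b : ℂ) : ℝ := a.re * b.re + a.im * b.im

lemma P12_eq (a b : Sp) : PB A12 a b =
    jj (a 0) (b 0) - jj (a 1) (b 1) + jj (a 2) (b 2) - jj (a 3) (b 3) := by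
  simp [PB_apply, A12, dotProduct, Matrix.mulVec, Fin.sum_univ_four, jj]; ring
lemma P13_eq (a b : Sp) : PB A13 a b =
    - rrp (a 0) (b 1) + rrp (a 1) (b 0) - rrp (a 2) (b 3) + rrp (a 3) (b 2) := by
  simp [PB_apply, A13, dotProduct, Matrix.mulVec, Fin.sum_univ_four, rrp]; ring
lemma P23_eq (a b : Sp) : PB A23 a b =
    jj (a 0) (b 1) + jj (a 1) (b 0) + jj (a 2) (b 3) + jj (a 3) (b 2) := by
  simp [PB_apply, A23, dotProduct, Matrix.mulVec, Fin.sum_univ_four, jj]; ring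
lemma P1_eq (a b : Sp) : PB 1 a b =
    rrp (a 0) (b 0) + rrp (a 1) (b 1) + rrp (a 2) (b 2) + rrp (a 3) (b 3) := by
  simp [PB_apply, dotProduct, Fin.sum_univ_four, rrp]

lemma P12_anti (a b) : PB A12 a b = - PB A12 b a := by simp only [P12_eq, jj]; ring
lemma P13_anti (a b) : PB A13 a b = - PB A13 b a := by simp only [P13_eq, rrp]; ring
lemma P23_anti (a b) : PB A23 a b = - PB A23 b a := by simp only [P23_eq, jj]; ring
lemma P1_symm (a b) : PB 1 a b = PB 1 b a := by simp only [P1_eq, rrp]; ring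
lemma P1_self (a : Sp) : PB 1 a a = ∑ i, ‖a i‖ ^ 2 := by
  simp only [P1_eq, rrp, Fin.sum_univ_four, Complex.sq_norm, Complex.normSq_apply]
lemma P1_nonneg (a : Sp) : 0 ≤ PB 1 a a := by rw [P1_self]; positivity

lemma dirac_sq (u : (Fin 3 → ℝ) → Sp) (x : Fin 3 → ℝ) :
    let a := fderiv ℝ u x (Pi.single 0 1)
    let b := fderiv ℝ u x (Pi.single 1 1)
    let c := fderiv ℝ u x (Pi.single 2 1)
    ∑ i, ‖diracOp u x i‖ ^ 2 = PB 1 a a + PB 1 b b + PB 1 c c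
      + 2 * (PB A12 a b + PB A13 a c + PB A23 b c) := by
  intro a b c
  simp only [diracOp]
  change ∑ i, ‖((-Complex.I) • (alpha1.mulVec a + alpha2.mulVec b + alpha3.mulVec c)) i‖ ^ 2 = _
  clear_value a b c
  simp only [P1_eq, P12_eq, P13_eq, P23_eq, jj, rrp, Fin.sum_univ_four, Complex.sq_norm,
    Complex.normSq_apply]
  simp [alpha1, alpha2, alpha3, dotProduct, Fin.sum_univ_four]
  ring

lemma bc_comp (ω : ℝ) (x) (v : Sp)
    (h : v + Complex.I • betaM.mulVec ((alphaDot (coneNormal ω x)).mulVec v) = 0) :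
    let n := coneNormal ω x
    v 2 = Complex.I * (n 2 * v 0 + (n 0 - Complex.I * n 1) * v 1) ∧
    v 3 = Complex.I * ((n 0 + Complex.I * n 1) * v 0 - n 2 * v 1) := by
  intro n
  change v + Complex.I • betaM.mulVec ((alphaDot n).mulVec v) = 0 at h
  clear_value n
  have h2 := congrFun h 2
  have h3 := congrFun h 3
  simp [betaM, alphaDot, alpha1, alpha2, alpha3, dotProduct,
    Fin.sum_univ_four] at h2 h3
  constructor
  · linear_combination h2
  · linear_combination h3

/-- radial boundary algebra -/
lemma alg_rad (C S e0 e1 : ℝ) (h1 : e0 ^ 2 + e1 ^ 2 = 1) (h2 : C ^ 2 + S ^ 2 = 1) (u p : Sp)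
    (hu2 : u 2 = Complex.I * (((-S : ℝ) : ℂ) * u 0 + (((C * e0 : ℝ) : ℂ) - Complex.I * ((C * e1 : ℝ) : ℂ)) * u 1))
    (hu3 : u 3 = Complex.I * ((((C * e0 : ℝ) : ℂ) + Complex.I * ((C * e1 : ℝ) : ℂ)) * u 0 - ((-S : ℝ) : ℂ) * u 1))
    (hp2 : p 2 = Complex.I * (((-S : ℝ) : ℂ) * p 0 + (((C * e0 : ℝ) : ℂ) - Complex.I * ((C * e1 : ℝ) : ℂ)) * p 1))
    (hp3 : p 3 = Complex.I * ((((C * e0 : ℝ) : ℂ) + Complex.I * ((C * e1 : ℝ) : ℂ)) * p 0 - ((-S : ℝ) : ℂ) * p 1)) :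
    e0 * PB A13 u p + e1 * PB A23 u p = 0 := by
  rw [P13_eq, P23_eq, hu2, hu3, hp2, hp3]
  simp only [jj, rrp]
  simp
  have hν : C ^ 2 * (e0 ^ 2 + e1 ^ 2) + S ^ 2 = 1 := by rw [h1]; linarith
  linear_combination (norm := (simp only [jj, rrp]; ring)) (- (e0 * (- rrp (u 0) (p 1) + rrp (u 1) (p 0)) +
    e1 * (jj (u 0) (p 1) + jj (u 1) (p 0)))) * hν

lemma alg_rot (C S e0 e1 : ℝ) (h1 : e0 ^ 2 + e1 ^ 2 = 1) (h2 : C ^ 2 + S ^ 2 = 1) (u q : Sp)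
    (hu2 : u 2 = Complex.I * (((-S : ℝ) : ℂ) * u 0 + (((C * e0 : ℝ) : ℂ) - Complex.I * ((C * e1 : ℝ) : ℂ)) * u 1))
    (hu3 : u 3 = Complex.I * ((((C * e0 : ℝ) : ℂ) + Complex.I * ((C * e1 : ℝ) : ℂ)) * u 0 - ((-S : ℝ) : ℂ) * u 1))
    (hq2 : q 2 = Complex.I * (((-S : ℝ) : ℂ) * q 0 + (((C * e0 : ℝ) : ℂ) - Complex.I * ((C * e1 : ℝ) : ℂ)) * q 1)
      + Complex.I * ((((- C * e1 : ℝ) : ℂ) - Complex.I * ((C * e0 : ℝ) : ℂ)) * u 1))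
    (hq3 : q 3 = Complex.I * ((((C * e0 : ℝ) : ℂ) + Complex.I * ((C * e1 : ℝ) : ℂ)) * q 0 - ((-S : ℝ) : ℂ) * q 1)
      + Complex.I * ((((- C * e1 : ℝ) : ℂ) + Complex.I * ((C * e0 : ℝ) : ℂ)) * u 0)) :
    C * PB A12 u q + S * (e0 * PB A23 u q - e1 * PB A13 u q) = C / 2 * PB 1 u u := by
  rw [P12_eq, P13_eq, P23_eq, P1_eq, hu2, hu3, hq2, hq3]
  simp only [jj, rrp]
  simp
  have hν : C ^ 2 * (e0 ^ 2 + e1 ^ 2) + S ^ 2 = 1 := by rw [h1]; linarith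
  linear_combination (norm := (simp only [jj, rrp]; ring)) (- (C * (jj (u 0) (q 0) - jj (u 1) (q 1)) + S * (e0 * (jj (u 0) (q 1) + jj (u 1) (q 0))
     - e1 * (- rrp (u 0) (q 1) + rrp (u 1) (q 0))))) * hν
    + 2 * C * S * (- S * (jj (u 0) (q 0) - jj (u 1) (q 1)) + C * (e0 * (jj (u 0) (q 1) + jj (u 1) (q 0))
     - e1 * (- rrp (u 0) (q 1) + rrp (u 1) (q 0)))) * h1
    + C * (rrp (u 0) (u 0) + rrp (u 1) (u 1)) * ((C ^ 2 + S ^ 2) * h1 + h2 - 1 / 2 * hν)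


lemma bc_deriv (w : ℝ → Sp) (w' : Sp) (n0 n1 : ℝ → ℝ) (n2 m0 m1 : ℝ)
    (hw : HasDerivAt w w' 0) (h0 : HasDerivAt n0 m0 0) (h1 : HasDerivAt n1 m1 0)
    (e2 : ∀ t, w t 2 = Complex.I * ((n2 : ℂ) * w t 0 + (n0 t - Complex.I * n1 t) * w t 1))
    (e3 : ∀ t, w t 3 = Complex.I * ((n0 t + Complex.I * n1 t) * w t 0 - (n2 : ℂ) * w t 1)) :
    w' 2 = Complex.I * ((n2 : ℂ) * w' 0 + (n0 0 - Complex.I * n1 0) * w' 1)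
      + Complex.I * ((m0 - Complex.I * m1) * w 0 1) ∧
    w' 3 = Complex.I * ((n0 0 + Complex.I * n1 0) * w' 0 - (n2 : ℂ) * w' 1)
      + Complex.I * ((m0 + Complex.I * m1) * w 0 0) := by
  have hc := hasDerivAt_pi.1 hw
  have c0 : HasDerivAt (fun t => (n0 t : ℂ)) m0 0 := h0.ofReal_comp
  have c1 : HasDerivAt (fun t => (n1 t : ℂ)) m1 0 := h1.ofReal_comp
  constructor
  · have h := ((((hc 0).const_mul (n2:ℂ)).add
      ((c0.sub (c1.const_mul Complex.I)).mul (hc 1))).const_mul Complex.I)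
    have h' := (hc 2).congr_of_eventuallyEq (f₁ := _) (Filter.Eventually.of_forall
      (fun t => (e2 t).symm))
    rw [h'.unique h]; simp only [Pi.sub_apply]; ring
  · have h := ((((c0.add (c1.const_mul Complex.I)).mul (hc 0)).sub
      ((hc 1).const_mul (n2:ℂ))).const_mul Complex.I)
    have h' := (hc 3).congr_of_eventuallyEq (f₁ := _) (Filter.Eventually.of_forall
      (fun t => (e3 t).symm))
    rw [h'.unique h]; simp only [Pi.add_apply]; ring

def F1 (v : Sp) (L : (Fin 3 → ℝ) →L[ℝ] Sp) : Fin 3 → ℝ :=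
  ![PB A12 v (L (Pi.single 1 1)) + PB A13 v (L (Pi.single 2 1)),
    - PB A12 v (L (Pi.single 0 1)) + PB A23 v (L (Pi.single 2 1)),
    - PB A13 v (L (Pi.single 0 1)) - PB A23 v (L (Pi.single 1 1))]

lemma L_expand (L : (Fin 3 → ℝ) →L[ℝ] Sp) (y : Fin 3 → ℝ) :
    L y = y 0 • L (Pi.single 0 1) + y 1 • L (Pi.single 1 1) + y 2 • L (Pi.single 2 1) := by
  rw [← map_smul, ← map_smul, ← map_smul, ← map_add, ← map_add]
  congr 1
  ext i; fin_cases i <;> simp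

lemma bdry_rho (ω : ℝ) (x : Fin 3 → ℝ) (hx : x ∈ ConeBoundary ω) (hx0 : x ≠ 0) :
    0 < x 0 ^ 2 + x 1 ^ 2 := by
  by_contra hcon
  have e0 : x 0 = 0 := by nlinarith [sq_nonneg (x 0), sq_nonneg (x 1)]
  have e1 : x 1 = 0 := by nlinarith [sq_nonneg (x 0), sq_nonneg (x 1)]
  have e2 : x 2 = 0 := by simpa [ConeBoundary, e0, e1] using hx
  apply hx0
  ext i; fin_cases i <;> simp [e0, e1, e2]

lemma bdry_SS (ω : ℝ) (x : Fin 3 → ℝ) (hx : x ∈ ConeBoundary ω) (hx0 : x ≠ 0) : x ∈ SS ω := by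
  refine ⟨(mem_closure_iff' ω x).2 ?_, hx0⟩
  rw [dv]; simp only [ConeBoundary, mem_ofPred_eq] at hx; linarith

lemma flux1 (ω : ℝ) (hω : ω ∈ Ioo 0 (π / 2)) (u : (Fin 3 → ℝ) → Sp)
    (hd : DifferentiableOn ℝ u (SS ω))
    (hbc : ∀ x ∈ ConeBoundary ω, x ≠ 0 →
        u x + Complex.I • betaM.mulVec ((alphaDot (coneNormal ω x)).mulVec (u x)) = 0)
    (x : Fin 3 → ℝ) (hx : x ∈ ConeBoundary ω) (hx0 : x ≠ 0) :
    ∑ j, F1 (u x) (fderivWithin ℝ u (SS ω) x) j * coneNormal ω x j =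
      Real.cos ω / (2 * Real.sqrt (x 0 ^ 2 + x 1 ^ 2)) * PB 1 (u x) (u x) := by
  have hs : 0 < Real.sin ω := Real.sin_pos_of_pos_of_lt_pi hω.1 (by linarith [hω.2, pi_pos])
  have hρ2 := bdry_rho ω x hx hx0
  have hL := (hd x (bdry_SS ω x hx hx0)).hasFDerivWithinAt
  set L := fderivWithin ℝ u (SS ω) x with hLdef
  set ρ := Real.sqrt (x 0 ^ 2 + x 1 ^ 2) with hρdef
  have hρ : 0 < ρ := Real.sqrt_pos.2 hρ2
  have hρs : ρ ^ 2 = x 0 ^ 2 + x 1 ^ 2 := Real.sq_sqrt hρ2.le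
  have hx2 : x 2 = Real.cos ω / Real.sin ω * ρ := hx
  set C := Real.cos ω with hCdef
  set S := Real.sin ω with hSdef
  have hCS : C ^ 2 + S ^ 2 = 1 := by rw [add_comm]; exact Real.sin_sq_add_cos_sq ω
  obtain ⟨e0, he0⟩ : ∃ e0, e0 = x 0 / ρ := ⟨_, rfl⟩
  obtain ⟨e1, he1⟩ : ∃ e1, e1 = x 1 / ρ := ⟨_, rfl⟩
  have hx0' : x 0 = ρ * e0 := by rw [he0]; field_simp
  have hx1' : x 1 = ρ * e1 := by rw [he1]; field_simp
  have hee : e0 ^ 2 + e1 ^ 2 = 1 := by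
    rw [he0, he1]; field_simp; linarith
  have hn : ∀ y : Fin 3 → ℝ, y 0 ^ 2 + y 1 ^ 2 = ρ ^ 2 →
      coneNormal ω y = ![C * (y 0 / ρ), C * (y 1 / ρ), -S] := by
    intro y hy
    simp only [coneNormal, hy, Real.sqrt_sq hρ.le, mul_div_assoc, hCdef, hSdef]
  have hnx := hn x hρs.symm
  -- values
  have hv := bc_comp ω x (u x) (hbc x hx hx0)
  -- radial curve
  have hrad := bc_deriv (fun t => u (Real.exp t • x)) (L x) (fun _ => C * e0) (fun _ => C * e1)
    (-S) 0 0 ?_ (hasDerivAt_const _ _) (hasDerivAt_const _ _) ?_ ?_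
  rotate_left
  · have hγ : HasDerivAt (fun t : ℝ => Real.exp t • x) x 0 := by
      simpa using (Real.hasDerivAt_exp 0).smul_const x
    have hL' : HasFDerivWithinAt u L (SS ω) (Real.exp 0 • x) := by simpa using hL
    refine hL'.comp_hasDerivAt (0:ℝ) hγ (Filter.Eventually.of_forall fun t => ?_)
    have ht := Real.exp_pos t
    refine bdry_SS ω _ ?_ (smul_ne_zero ht.ne' hx0)
    simp only [ConeBoundary, mem_ofPred_eq, Pi.smul_apply, smul_eq_mul]
    have : (rexp t * x 0) ^ 2 + (rexp t * x 1) ^ 2 = (rexp t * ρ) ^ 2 := by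
      rw [mul_pow _ ρ, hρs]; ring
    rw [this, Real.sqrt_sq (by positivity), hx2]; ring
  · intro t
    have ht := Real.exp_pos t
    have this : (rexp t * x 0) ^ 2 + (rexp t * x 1) ^ 2 = (rexp t * ρ) ^ 2 := by
      rw [mul_pow _ ρ, hρs]; ring
    have hmem : rexp t • x ∈ ConeBoundary ω := by
      simp only [ConeBoundary, mem_ofPred_eq, Pi.smul_apply, smul_eq_mul]
      rw [this, Real.sqrt_sq (by positivity), hx2]; ring
    have hcn : coneNormal ω (rexp t • x) = ![C * e0, C * e1, -S] := by
      simp only [coneNormal, Pi.smul_apply, smul_eq_mul]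
      rw [this, Real.sqrt_sq (by positivity), he0, he1, ← hCdef, ← hSdef]
      have k0 : C * (rexp t * x 0) / (rexp t * ρ) = C * (x 0 / ρ) := by field_simp
      have k1 : C * (rexp t * x 1) / (rexp t * ρ) = C * (x 1 / ρ) := by field_simp
      rw [k0, k1]
    have h := (bc_comp ω _ _ (hbc _ hmem (smul_ne_zero ht.ne' hx0))).1
    rw [hcn] at h
    simpa using h
  · intro t
    have ht := Real.exp_pos t
    have this : (rexp t * x 0) ^ 2 + (rexp t * x 1) ^ 2 = (rexp t * ρ) ^ 2 := by
      rw [mul_pow _ ρ, hρs]; ring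
    have hmem : rexp t • x ∈ ConeBoundary ω := by
      simp only [ConeBoundary, mem_ofPred_eq, Pi.smul_apply, smul_eq_mul]
      rw [this, Real.sqrt_sq (by positivity), hx2]; ring
    have hcn : coneNormal ω (rexp t • x) = ![C * e0, C * e1, -S] := by
      simp only [coneNormal, Pi.smul_apply, smul_eq_mul]
      rw [this, Real.sqrt_sq (by positivity), he0, he1, ← hCdef, ← hSdef]
      have k0 : C * (rexp t * x 0) / (rexp t * ρ) = C * (x 0 / ρ) := by field_simp
      have k1 : C * (rexp t * x 1) / (rexp t * ρ) = C * (x 1 / ρ) := by field_simp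
      rw [k0, k1]
    have h := (bc_comp ω _ _ (hbc _ hmem (smul_ne_zero ht.ne' hx0))).2
    rw [hcn] at h
    simpa using h
  -- rotation
  set γ : ℝ → (Fin 3 → ℝ) := fun t => ![Real.cos t * x 0 - Real.sin t * x 1,
    Real.sin t * x 0 + Real.cos t * x 1, x 2] with hγdef
  have hγρ : ∀ t, γ t 0 ^ 2 + γ t 1 ^ 2 = ρ ^ 2 := by
    intro t
    simp only [hγdef, Matrix.cons_val_zero, Matrix.cons_val_one]
    rw [hρs]
    linear_combination (x 0 ^ 2 + x 1 ^ 2) * Real.sin_sq_add_cos_sq t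
  have hγm : ∀ t, γ t ∈ ConeBoundary ω := by
    intro t
    simp only [ConeBoundary, mem_ofPred_eq, hγρ, Real.sqrt_sq hρ.le]
    simpa [hγdef] using hx2
  have hγ0 : ∀ t, γ t ≠ 0 := by
    intro t h
    have := hγρ t
    rw [h] at this
    simp at this
    nlinarith
  have hγx : γ 0 = x := by
    ext i; fin_cases i <;> simp [hγdef]
  have d0 : HasDerivAt (fun t => Real.cos t * x 0 - Real.sin t * x 1) (- x 1) 0 := by
    have h := ((Real.hasDerivAt_cos 0).mul_const (x 0)).sub
      ((Real.hasDerivAt_sin 0).mul_const (x 1))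
    exact h.congr_deriv (by simp)
  have d1 : HasDerivAt (fun t => Real.sin t * x 0 + Real.cos t * x 1) (x 0) 0 := by
    have h := ((Real.hasDerivAt_sin 0).mul_const (x 0)).add
      ((Real.hasDerivAt_cos 0).mul_const (x 1))
    exact h.congr_deriv (by simp)
  have hrot := bc_deriv (fun t => u (γ t)) (L ![- x 1, x 0, 0])
    (fun t => C * ((Real.cos t * x 0 - Real.sin t * x 1) / ρ))
    (fun t => C * ((Real.sin t * x 0 + Real.cos t * x 1) / ρ))
    (-S) (C * (- x 1 / ρ)) (C * (x 0 / ρ)) ?_ ((d0.div_const ρ).const_mul C)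
    ((d1.div_const ρ).const_mul C) ?_ ?_
  rotate_left
  · have hγ' : HasDerivAt γ ![- x 1, x 0, 0] 0 := by
      rw [hasDerivAt_pi]
      intro i
      fin_cases i
      · exact d0
      · exact d1
      · exact hasDerivAt_const _ _
    have hL' : HasFDerivWithinAt u L (SS ω) (γ 0) := by rw [hγx]; exact hL
    exact hL'.comp_hasDerivAt (0:ℝ) hγ' (Filter.Eventually.of_forall fun t =>
      bdry_SS ω _ (hγm t) (hγ0 t))
  · intro t
    have h := (bc_comp ω _ _ (hbc _ (hγm t) (hγ0 t))).1
    rw [hn _ (hγρ t)] at h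
    simpa [hγdef] using h
  · intro t
    have h := (bc_comp ω _ _ (hbc _ (hγm t) (hγ0 t))).2
    rw [hn _ (hγρ t)] at h
    simpa [hγdef] using h
  -- algebra
  simp only [hγx] at hrot
  rw [hnx] at hv
  simp only [Matrix.cons_val_zero, Matrix.cons_val_one, Matrix.cons_val, ← he0, ← he1] at hv
  have r1 := alg_rad C S e0 e1 hee hCS (u x) (L x) hv.1 hv.2
    (by simpa using hrad.1) (by simpa using hrad.2)
  have r2 := alg_rot C S e0 e1 hee hCS (u x) (L ![- x 1, x 0, 0]) hv.1 hv.2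
    (by simpa [he0, he1, neg_div] using hrot.1) (by simpa [he0, he1, neg_div] using hrot.2)
  rw [L_expand] at r1 r2
  simp only [map_add, map_smul, smul_eq_mul, hx0', hx1', hx2, Matrix.cons_val_zero,
    Matrix.cons_val_one, Matrix.cons_val] at r1 r2
  rw [hnx, ← he0, ← he1]
  simp only [F1, Fin.sum_univ_three, Matrix.cons_val_zero, Matrix.cons_val_one, Matrix.cons_val]
  generalize PB A12 (u x) (L (Pi.single 0 1)) = a12 at *
  generalize PB A12 (u x) (L (Pi.single 1 1)) = b12 at *
  generalize PB A12 (u x) (L (Pi.single 2 1)) = c12 at *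
  generalize PB A13 (u x) (L (Pi.single 0 1)) = a13 at *
  generalize PB A13 (u x) (L (Pi.single 1 1)) = b13 at *
  generalize PB A13 (u x) (L (Pi.single 2 1)) = c13 at *
  generalize PB A23 (u x) (L (Pi.single 0 1)) = a23 at *
  generalize PB A23 (u x) (L (Pi.single 1 1)) = b23 at *
  generalize PB A23 (u x) (L (Pi.single 2 1)) = c23 at *
  generalize PB 1 (u x) (u x) = N at *
  clear_value C S ρ
  clear hrad hrot hv hn hnx hγρ hγm hγ0 hγx d0 d1 hL
  have r3 : e0 * (S * (e0 * a13 + e1 * b13) + C * c13) + e1 * (S * (e0 * a23 + e1 * b23) + C * c23) = 0 := by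
    field_simp at r1
    rw [mul_zero] at r1
    have r1' := (mul_eq_zero.1 r1).resolve_left hρ.ne'
    linear_combination r1'
  have r4 : C * (e0 * b12 - e1 * a12) + S * (e0 * (e0 * b23 - e1 * a23) - e1 * (e0 * b13 - e1 * a13)) = C / (2 * ρ) * N := by
    field_simp
    linear_combination 2 * r2
  linear_combination r3 + r4 - S * (a13 + b23) * hee


def rad (x : Fin 3 → ℝ) : ℝ := Real.sqrt (x 0 ^ 2 + x 1 ^ 2 + x 2 ^ 2)

def XX (a : ℝ) (x : Fin 3 → ℝ) : Fin 3 → ℝ :=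
  ![x 0 * ((1 / 2 + a) / rad x ^ 2 - a / (rad x * (rad x + x 2))),
    x 1 * ((1 / 2 + a) / rad x ^ 2 - a / (rad x * (rad x + x 2))),
    (1 / 2 + a) * x 2 / rad x ^ 2 - a / rad x]

lemma rad_sq (x) : rad x ^ 2 = x 0 ^ 2 + x 1 ^ 2 + x 2 ^ 2 := Real.sq_sqrt (by positivity)

lemma rad_contDiffAt (x) (hr : 0 < rad x) : ContDiffAt ℝ 1 rad x := by
  unfold rad
  exact ContDiffAt.sqrt (by fun_prop) (Real.sqrt_pos.1 hr).ne'

lemma XX_contDiffAt (a : ℝ) (x) (hr : 0 < rad x) (hz : 0 ≤ x 2) (j : Fin 3) :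
    ContDiffAt ℝ 1 (fun y => XX a y j) x := by
  have h := rad_contDiffAt x hr
  have hp : ∀ i : Fin 3, ContDiffAt ℝ 1 (fun y : Fin 3 → ℝ => y i) x := fun i => by fun_prop
  have hh : ContDiffAt ℝ 1 (fun x : Fin 3 → ℝ =>
      (1 / 2 + a) / rad x ^ 2 - a / (rad x * (rad x + x 2))) x := by
    refine ContDiffAt.sub (contDiffAt_const.div (h.pow 2) (by positivity))
      (contDiffAt_const.div (h.mul (h.add (hp 2))) (by positivity))
  fin_cases j
  · exact (hp 0).mul hh
  · exact (hp 1).mul hh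
  · exact ((contDiffAt_const.mul (hp 2)).div (h.pow 2) (by positivity)).sub
      (contDiffAt_const.div h (by positivity))

lemma fderiv_of_line (f : (Fin 3 → ℝ) → ℝ) (x v : Fin 3 → ℝ) (d : ℝ) (hf : DifferentiableAt ℝ f x)
    (h : HasDerivAt (fun t : ℝ => f (x + t • v)) d 0) : fderiv ℝ f x v = d := by
  have h1 : HasDerivAt (fun t : ℝ => x + t • v) v 0 := by
    have := ((hasDerivAt_id (0:ℝ)).smul_const v).const_add x
    rw [one_smul] at this; exact this
  have h2 : HasFDerivAt f (fderiv ℝ f x) (x + (0:ℝ) • v) := by simpa using hf.hasFDerivAt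
  exact (h2.comp_hasDerivAt (0:ℝ) h1).unique h

lemma rad_line (x : Fin 3 → ℝ) (hr : 0 < rad x) (j : Fin 3) :
    HasDerivAt (fun t : ℝ => rad (x + t • (Pi.single j 1 : Fin 3 → ℝ))) (x j / rad x) 0 := by
  have hp : ∀ i : Fin 3, HasDerivAt (fun t : ℝ => (x + t • (Pi.single j 1 : Fin 3 → ℝ)) i)
      ((Pi.single j 1 : Fin 3 → ℝ) i) 0 := by
    intro i
    simp only [Pi.add_apply, Pi.smul_apply, smul_eq_mul]
    simpa using ((hasDerivAt_id (0:ℝ)).mul_const ((Pi.single j 1 : Fin 3 → ℝ) i)).const_add (x i)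
  have h := ((((hp 0).pow 2).add ((hp 1).pow 2)).add ((hp 2).pow 2)).sqrt
    (by simpa using (Real.sqrt_pos.1 hr).ne')
  refine h.congr_deriv ?_
  have e : √(x 0 ^ 2 + x 1 ^ 2 + x 2 ^ 2) = rad x := rfl
  fin_cases j <;> simp [e] <;> field_simp

lemma div_XX (a : ℝ) (x) (hr : 0 < rad x) (hz : 0 ≤ x 2) :
    ∑ j, fderiv ℝ (fun y => XX a y j) x (Pi.single j 1) - ∑ j, XX a x j ^ 2 =
      (1 / 4 + a - a ^ 2 * ((rad x - x 2) / (rad x + x 2))) / rad x ^ 2 := by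
  have hd : ∀ j, DifferentiableAt ℝ (fun y => XX a y j) x := fun j =>
    (XX_contDiffAt a x hr hz j).differentiableAt (by simp)
  have hp : ∀ j i : Fin 3, HasDerivAt (fun t : ℝ => (x + t • (Pi.single j 1 : Fin 3 → ℝ)) i)
      ((Pi.single j 1 : Fin 3 → ℝ) i) 0 := by
    intro j i
    simp only [Pi.add_apply, Pi.smul_apply, smul_eq_mul]
    simpa using ((hasDerivAt_id (0:ℝ)).mul_const ((Pi.single j 1 : Fin 3 → ℝ) i)).const_add (x i)
  have hR := rad_line x hr
  have hx0 : ∀ j, x + (0:ℝ) • (Pi.single j 1 : Fin 3 → ℝ) = x := by intro j; simp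
  have hrz : 0 < rad x + x 2 := by linarith
  have hh : ∀ j : Fin 3, HasDerivAt (fun t : ℝ =>
      (1 / 2 + a) / rad (x + t • (Pi.single j 1 : Fin 3 → ℝ)) ^ 2
        - a / (rad (x + t • (Pi.single j 1 : Fin 3 → ℝ)) *
          (rad (x + t • (Pi.single j 1 : Fin 3 → ℝ)) + (x + t • (Pi.single j 1 : Fin 3 → ℝ)) 2)))
      (- (1 / 2 + a) * (2 * rad x * (x j / rad x)) / (rad x ^ 2) ^ 2
        + a * (x j / rad x * (rad x + x 2) + rad x * (x j / rad x + (Pi.single j 1 : Fin 3 → ℝ) 2))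
          / (rad x * (rad x + x 2)) ^ 2) 0 := by
    intro j
    have h := ((hasDerivAt_const (0:ℝ) (1 / 2 + a)).div ((hR j).pow 2)
      (by simp only [Pi.pow_apply, hx0]; positivity)).sub ((hasDerivAt_const (0:ℝ) a).div
      ((hR j).mul ((hR j).add (hp j 2))) (by simp only [Pi.mul_apply, Pi.add_apply (f := fun t : ℝ => _), hx0]; positivity))
    refine h.congr_deriv ?_
    simp only [hx0, Pi.mul_apply, Pi.pow_apply, Pi.add_apply (f := fun t : ℝ => _)]
    push_cast
    ring
  have f0 := fderiv_of_line _ x (Pi.single 0 1) _ (hd 0) ((hp 0 0).mul (hh 0))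
  have f1 := fderiv_of_line _ x (Pi.single 1 1) _ (hd 1) ((hp 1 1).mul (hh 1))
  have h2 := (((hp 2 2).const_mul (1 / 2 + a)).div ((hR 2).pow 2)
      (by simp only [Pi.pow_apply, hx0]; positivity)).sub ((hasDerivAt_const (0:ℝ) a).div (hR 2)
      (by simp only [hx0]; positivity))
  have f2 := fderiv_of_line _ x (Pi.single 2 1) _ (hd 2) h2
  rw [Fin.sum_univ_three, f0, f1, f2, Fin.sum_univ_three]
  simp only [XX, hx0, Matrix.cons_val_zero, Matrix.cons_val_one, Matrix.cons_val, Pi.pow_apply]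
  have hsq := rad_sq x
  simp
  have hw : x 1 ^ 2 = rad x ^ 2 - x 2 ^ 2 - x 0 ^ 2 := by linarith
  generalize rad x = r at *
  field_simp
  generalize x 0 = p at *
  generalize x 1 = q at *
  generalize x 2 = z at *
  clear hd hp hR hx0 hh f0 f1 f2 h2
  ring_nf
  simp only [hw]
  ring_nf


lemma XX_flux (ω : ℝ) (hω : ω ∈ Ioo 0 (π / 2)) (x : Fin 3 → ℝ) (hx : x ∈ ConeBoundary ω)
    (hx0 : x ≠ 0) :
    ∑ j, XX (Real.cos ω / (2 * (1 - Real.cos ω))) x j * coneNormal ω x j =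
      Real.cos ω / (2 * Real.sqrt (x 0 ^ 2 + x 1 ^ 2)) := by
  have hS : 0 < Real.sin ω := Real.sin_pos_of_pos_of_lt_pi hω.1 (by linarith [hω.2, pi_pos])
  have hC : 0 < Real.cos ω := Real.cos_pos_of_mem_Ioo ⟨by linarith [hω.1, pi_pos], hω.2⟩
  have hCS := Real.sin_sq_add_cos_sq ω
  have hρ2 := bdry_rho ω x hx hx0
  have hx2 : x 2 = Real.cos ω / Real.sin ω * Real.sqrt (x 0 ^ 2 + x 1 ^ 2) := hx
  simp only [XX, coneNormal, Fin.sum_univ_three, Matrix.cons_val_zero, Matrix.cons_val_one,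
    Matrix.cons_val]
  have hρ := Real.sqrt_pos.2 hρ2
  have hρs := Real.sq_sqrt hρ2.le
  have hr : rad x = Real.sqrt (x 0 ^ 2 + x 1 ^ 2) / Real.sin ω := by
    rw [rad, Real.sqrt_eq_iff_mul_self_eq (by positivity) (by positivity), hx2]
    field_simp
    rw [hρs]
    linear_combination (x 0 ^ 2 + x 1 ^ 2) * hCS
  rw [hr, hx2]
  generalize √(x 0 ^ 2 + x 1 ^ 2) = ρ at *
  generalize Real.cos ω = C at *
  generalize Real.sin ω = S at *
  have hC1 : 0 < 1 - C := by nlinarith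
  have hC2 : 0 < 1 + C := by linarith
  have key : ρ ^ 2 - (x 0 ^ 2 + x 1 ^ 2) = 0 := by linarith
  field_simp
  have h1 : x 0 ^ 2 = ρ ^ 2 - x 1 ^ 2 := by linarith
  have h2 : S ^ 2 = (1 - C) * (1 + C) := by linarith
  ring_nf
  simp only [h1, show S ^ 3 = S * S ^ 2 by ring, show S ^ 4 = S ^ 2 * S ^ 2 by ring, h2]
  ring

lemma const_bound (ω : ℝ) (hω : ω ∈ Ioo 0 (π / 2)) (x : Fin 3 → ℝ) (hx : x ∈ Cone ω)
    (hr : 0 < rad x) (a : ℝ) (ha : a = Real.cos ω / (2 * (1 - Real.cos ω))) :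
    (π / (4 * ω)) ^ 2 ≤ 1 / 4 + a - a ^ 2 * ((rad x - x 2) / (rad x + x 2)) := by
  refine (scalar_ineq ω hω).trans ?_
  have hS : 0 < Real.sin ω := Real.sin_pos_of_pos_of_lt_pi hω.1 (by linarith [hω.2, pi_pos])
  have hC : 0 < Real.cos ω := Real.cos_pos_of_mem_Ioo ⟨by linarith [hω.1, pi_pos], hω.2⟩
  have hCS := Real.sin_sq_add_cos_sq ω
  have hx' : x 2 > (Real.cos ω / Real.sin ω) * Real.sqrt ((x 0) ^ 2 + (x 1) ^ 2) := hx
  have hρs := Real.sq_sqrt (show 0 ≤ x 0 ^ 2 + x 1 ^ 2 by positivity)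
  have hρ := Real.sqrt_nonneg (x 0 ^ 2 + x 1 ^ 2)
  have hrs := rad_sq x
  generalize √(x 0 ^ 2 + x 1 ^ 2) = ρ at *
  have hz : 0 < x 2 := lt_of_le_of_lt (by positivity) hx'
  have hz2 : Real.cos ω * rad x ≤ x 2 := by
    refine abs_le_of_sq_le_sq' ?_ hz.le |>.2
    have h1 : Real.cos ω * ρ < x 2 * Real.sin ω := by
      rw [gt_iff_lt, div_mul_eq_mul_div, div_lt_iff₀ hS] at hx'; exact hx'
    have h2 : (Real.cos ω * ρ) ^ 2 ≤ (x 2 * Real.sin ω) ^ 2 :=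
      pow_le_pow_left₀ (by positivity) h1.le 2
    rw [mul_pow, hrs, ← hρs]
    nlinarith
  generalize Real.cos ω = C at *
  generalize Real.sin ω = S at *
  have hC1 : 0 < 1 - C := by nlinarith
  have h3 : (rad x - x 2) / (rad x + x 2) ≤ (1 - C) / (1 + C) := by
    rw [div_le_div_iff₀ (by positivity) (by positivity)]
    nlinarith
  have h4 : a ^ 2 * ((rad x - x 2) / (rad x + x 2)) ≤ a ^ 2 * ((1 - C) / (1 + C)) :=
    mul_le_mul_of_nonneg_left h3 (sq_nonneg a)
  have h5 : (1 + 2 * C) / (4 * S ^ 2) = 1 / 4 + a - a ^ 2 * ((1 - C) / (1 + C)) := by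
    have : S ^ 2 = (1 - C) * (1 + C) := by linarith
    rw [this, ha]
    field_simp
    ring
  linarith

lemma SS_facts (ω : ℝ) (hω : ω ∈ Ioo 0 (π / 2)) (x : Fin 3 → ℝ) (hx : x ∈ SS ω) :
    0 < rad x ∧ 0 ≤ x 2 := by
  have hS : 0 < Real.sin ω := Real.sin_pos_of_pos_of_lt_pi hω.1 (by linarith [hω.2, pi_pos])
  have hC : 0 < Real.cos ω := Real.cos_pos_of_mem_Ioo ⟨by linarith [hω.1, pi_pos], hω.2⟩
  constructor
  · refine lt_of_le_of_ne (Real.sqrt_nonneg _) fun h => hx.2 ?_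
    have h1 := rad_sq x
    rw [← h] at h1
    have e0 : x 0 = 0 := by nlinarith [sq_nonneg (x 0), sq_nonneg (x 1), sq_nonneg (x 2)]
    have e1 : x 1 = 0 := by nlinarith [sq_nonneg (x 0), sq_nonneg (x 1), sq_nonneg (x 2)]
    have e2 : x 2 = 0 := by nlinarith [sq_nonneg (x 0), sq_nonneg (x 1), sq_nonneg (x 2)]
    ext i; fin_cases i <;> simp [e0, e1, e2]
  · have := (mem_closure_iff' ω x).1 hx.1
    rw [dv] at this
    have : 0 ≤ cos ω / sin ω * √(x 0 ^ 2 + x 1 ^ 2) := by positivity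
    linarith

lemma PB_hasFDerivAt (A) (u v : (Fin 3 → ℝ) → Sp) (u' v' : (Fin 3 → ℝ) →L[ℝ] Sp) (x)
    (hu : HasFDerivAt u u' x) (hv : HasFDerivAt v v' x) :
    ∃ D : (Fin 3 → ℝ) →L[ℝ] ℝ, HasFDerivAt (fun y => PB A (u y) (v y)) D x ∧
      ∀ w, D w = PB A (u x) (v' w) + PB A (u' w) (v x) :=
  ⟨_, (PB A).hasFDerivAt_of_bilinear hu hv, fun w => by simp⟩

/-- integrability on the cone -/
lemma intOn (ω : ℝ) (K : Set (Fin 3 → ℝ)) (hK : IsCompact K) (g g' : (Fin 3 → ℝ) → ℝ)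
    (hg' : ContinuousOn g' K) (heq : ∀ x ∈ Cone ω, g x = g' x)
    (h0 : ∀ x ∈ Cone ω, x ∉ K → g x = 0) : IntegrableOn g (Cone ω) := by
  have hm := (cone_isOpen ω).measurableSet
  have h1 : IntegrableOn g' (Cone ω ∩ K) := (hg'.integrableOn_compact hK).mono_set inter_subset_right
  have h2 : IntegrableOn g (Cone ω ∩ K) :=
    h1.congr_fun (fun x hx => (heq x hx.1).symm) (hm.inter hK.measurableSet)
  refine h2.of_forall_diff_eq_zero hm ?_
  rintro x ⟨hx, hxn⟩
  exact h0 x hx fun h => hxn ⟨hx, h⟩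

def FF (ω a : ℝ) (u : (Fin 3 → ℝ) → Sp) (j : Fin 3) (y : Fin 3 → ℝ) : ℝ :=
  F1 (u y) (fderivWithin ℝ u (SS ω) y) j - XX a y j * PB 1 (u y) (u y)

lemma PB_contDiffOn (A) (s : Set (Fin 3 → ℝ)) (u v : (Fin 3 → ℝ) → Sp)
    (hu : ContDiffOn ℝ 1 u s) (hv : ContDiffOn ℝ 1 v s) :
    ContDiffOn ℝ 1 (fun y => PB A (u y) (v y)) s :=
  ((PB A).contDiff.comp_contDiffOn hu).clm_apply hv

lemma FF_contDiffOn (ω : ℝ) (hω : ω ∈ Ioo 0 (π / 2)) (a : ℝ) (u : (Fin 3 → ℝ) → Sp)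
    (hu : ContDiffOn ℝ 2 u (SS ω)) (j : Fin 3) : ContDiffOn ℝ 1 (FF ω a u j) (SS ω) := by
  have hu1 : ContDiffOn ℝ 1 u (SS ω) := hu.of_le (by norm_num)
  have hD : ContDiffOn ℝ 1 (fderivWithin ℝ u (SS ω)) (SS ω) :=
    hu.fderivWithin (SS_uniqueDiff ω hω) (by norm_num)
  have hE : ∀ e, ContDiffOn ℝ 1 (fun y => fderivWithin ℝ u (SS ω) y e) (SS ω) := fun e =>
    hD.clm_apply contDiffOn_const
  have hP : ∀ A e, ContDiffOn ℝ 1 (fun y => PB A (u y) (fderivWithin ℝ u (SS ω) y e)) (SS ω) :=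
    fun A e => PB_contDiffOn A _ _ _ hu1 (hE e)
  have hX : ContDiffOn ℝ 1 (fun y => XX a y j * PB 1 (u y) (u y)) (SS ω) :=
    ContDiffOn.mul (fun x hx => (XX_contDiffAt a x (SS_facts ω hω x hx).1
      (SS_facts ω hω x hx).2 j).contDiffWithinAt) (PB_contDiffOn 1 _ _ _ hu1 hu1)
  refine ContDiffOn.sub ?_ hX
  fin_cases j
  · exact (hP _ _).add (hP _ _)
  · exact (hP _ _).neg.add (hP _ _)
  · exact (hP _ _).neg.sub (hP _ _)

lemma pointwise (ω : ℝ) (hω : ω ∈ Ioo 0 (π / 2)) (a : ℝ)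
    (ha : a = Real.cos ω / (2 * (1 - Real.cos ω))) (u : (Fin 3 → ℝ) → Sp)
    (hu : ContDiffOn ℝ 2 u (SS ω)) (x : Fin 3 → ℝ) (hx : x ∈ Cone ω) :
    ∑ j, fderiv ℝ (FF ω a u j) x (Pi.single j 1)
      + (π / (4 * ω)) ^ 2 * ((∑ i, ‖u x i‖ ^ 2) / (∑ j, (x j) ^ 2)) ≤
      ∑ i, ‖diracOp u x i‖ ^ 2 := by
  obtain ⟨hr, hz⟩ := SS_facts ω hω x (cone_sub_SS ω hx)
  have hdiv := div_XX a x hr hz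
  have hcb := const_bound ω hω x hx hr a ha
  have hus : ContDiffAt ℝ 2 u x := hu.contDiffAt (SS_nhds ω hx)
  have hud : HasFDerivAt u (fderiv ℝ u x) x := (hus.differentiableAt (by simp)).hasFDerivAt
  have hev : fderivWithin ℝ u (SS ω) =ᶠ[nhds x] fderiv ℝ u := by
    filter_upwards [(cone_isOpen ω).mem_nhds hx] with y hy
    exact fderivWithin_of_mem_nhds (SS_nhds ω hy)
  have hG : HasFDerivAt (fderivWithin ℝ u (SS ω)) (fderiv ℝ (fderiv ℝ u) x) x := by
    have h1 : ContDiffAt ℝ 1 (fderiv ℝ u) x := hus.fderiv_right (by norm_num)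
    exact (h1.differentiableAt (by simp)).hasFDerivAt.congr_of_eventuallyEq hev
  have hsymm : ∀ v w, fderiv ℝ (fderiv ℝ u) x v w = fderiv ℝ (fderiv ℝ u) x w v := by
    intro v w
    exact (hus.isSymmSndFDerivAt (by simp)).eq v w
  have hGe : ∀ e, ∃ D : (Fin 3 → ℝ) →L[ℝ] Sp,
      HasFDerivAt (fun y => fderivWithin ℝ u (SS ω) y e) D x ∧
      ∀ w, D w = fderiv ℝ (fderiv ℝ u) x w e := by
    intro e
    exact ⟨_, hG.clm_apply (hasFDerivAt_const e x), fun w => by simp⟩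
  have hPe : ∀ A e, ∃ D : (Fin 3 → ℝ) →L[ℝ] ℝ,
      HasFDerivAt (fun y => PB A (u y) (fderivWithin ℝ u (SS ω) y e)) D x ∧
      ∀ w, D w = PB A (u x) (fderiv ℝ (fderiv ℝ u) x w e)
        + PB A (fderiv ℝ u x w) (fderiv ℝ u x e) := by
    intro A e
    obtain ⟨D, hD, hD'⟩ := hGe e
    obtain ⟨E, hE, hE'⟩ := PB_hasFDerivAt A u _ _ D x hud hD
    exact ⟨E, hE, fun w => by rw [hE', hD', hev.eq_of_nhds]⟩
  obtain ⟨DN, hDN, hDN'⟩ := PB_hasFDerivAt 1 u u _ _ x hud hud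
  have hX : ∀ j, HasFDerivAt (fun y => XX a y j) (fderiv ℝ (fun y => XX a y j) x) x := fun j =>
    ((XX_contDiffAt a x hr hz j).differentiableAt (by simp)).hasFDerivAt
  choose DP hDP hDP' using hPe
  have f0 : fderiv ℝ (FF ω a u 0) x = _ :=
    (((hDP A12 (Pi.single 1 1)).add (hDP A13 (Pi.single 2 1))).sub ((hX 0).mul hDN)).fderiv
  have f1 : fderiv ℝ (FF ω a u 1) x = _ :=
    (((hDP A12 (Pi.single 0 1)).neg.add (hDP A23 (Pi.single 2 1))).sub ((hX 1).mul hDN)).fderiv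
  have f2 : fderiv ℝ (FF ω a u 2) x = _ :=
    (((hDP A13 (Pi.single 0 1)).neg.sub (hDP A23 (Pi.single 1 1))).sub ((hX 2).mul hDN)).fderiv
  have hds := dirac_sq u x
  simp only at hds
  rw [hds, ← P1_self]
  have hrs : ∑ j, x j ^ 2 = rad x ^ 2 := by rw [rad_sq, Fin.sum_univ_three]
  rw [hrs]
  rw [Fin.sum_univ_three] at hdiv ⊢
  rw [f0, f1, f2]
  simp only [ContinuousLinearMap.add_apply, ContinuousLinearMap.sub_apply,
    ContinuousLinearMap.neg_apply, ContinuousLinearMap.smul_apply, smul_eq_mul, hDP', hDN']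
  rw [hsymm (Pi.single 1 1) (Pi.single 0 1), hsymm (Pi.single 2 1) (Pi.single 0 1),
    hsymm (Pi.single 2 1) (Pi.single 1 1)]
  rw [Fin.sum_univ_three] at hdiv
  have n0 := P1_nonneg (fderiv ℝ u x (Pi.single 0 1) + XX a x 0 • u x)
  have n1 := P1_nonneg (fderiv ℝ u x (Pi.single 1 1) + XX a x 1 • u x)
  have n2 := P1_nonneg (fderiv ℝ u x (Pi.single 2 1) + XX a x 2 • u x)
  have hN := P1_nonneg (u x)
  generalize fderiv ℝ (fun y => XX a y 0) x (Pi.single 0 1) = X0 at *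
  generalize fderiv ℝ (fun y => XX a y 1) x (Pi.single 1 1) = X1 at *
  generalize fderiv ℝ (fun y => XX a y 2) x (Pi.single 2 1) = X2 at *
  generalize XX a x 0 = Y0 at *
  generalize XX a x 1 = Y1 at *
  generalize XX a x 2 = Y2 at *
  generalize fderiv ℝ u x (Pi.single 0 1) = d0 at *
  generalize fderiv ℝ u x (Pi.single 1 1) = d1 at *
  generalize fderiv ℝ u x (Pi.single 2 1) = d2 at *
  simp only [map_add, map_smul, ContinuousLinearMap.add_apply, ContinuousLinearMap.smul_apply,
    smul_eq_mul] at n0 n1 n2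
  rw [P1_symm d0 (u x)] at n0 ⊢
  rw [P1_symm d1 (u x)] at n1 ⊢
  rw [P1_symm d2 (u x)] at n2 ⊢
  rw [P12_anti d1 d0, P13_anti d2 d0, P23_anti d2 d1]
  have key : (π / (4 * ω)) ^ 2 * (PB 1 (u x) (u x) / rad x ^ 2) ≤
      (X0 + X1 + X2 - (Y0 ^ 2 + Y1 ^ 2 + Y2 ^ 2)) * PB 1 (u x) (u x) := by
    rw [hdiv, div_mul_eq_mul_div, ← mul_div_assoc]
    gcongr
  generalize (π / (4 * ω)) ^ 2 * (PB 1 (u x) (u x) / rad x ^ 2) = T at *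
  linarith

lemma main_thm (ω : ℝ) (hω : ω ∈ Ioo 0 (π / 2))
    (u : (Fin 3 → ℝ) → (Fin 4 → ℂ)) (hu : u ∈ MITDomain ω) :
    ∫ x in Cone ω, (∑ i, ‖diracOp u x i‖ ^ 2) ≥
      (π / (4 * ω)) ^ 2 * ∫ x in Cone ω, (∑ i, ‖u x i‖ ^ 2) / (∑ j, (x j) ^ 2) := by
  obtain ⟨hsm, hK, hKS, hbc⟩ := hu
  have hu2 : ContDiffOn ℝ 2 u (SS ω) := hsm.of_le (WithTop.coe_le_coe.2 (le_top : (2 : ℕ∞) ≤ ⊤))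
  obtain ⟨a, ha⟩ : ∃ a, a = Real.cos ω / (2 * (1 - Real.cos ω)) := ⟨_, rfl⟩
  have hFC := FF_contDiffOn ω hω a u hu2
  have hu0 : ∀ x ∉ tsupport u, u x = 0 := fun x hx => image_eq_zero_of_notMem_tsupport hx
  have hF0 : ∀ j, ∀ x ∉ tsupport u, FF ω a u j x = 0 := by
    intro j x hx
    rw [FF, hu0 x hx]
    fin_cases j <;> simp [F1]
  have hdz := div_zero_flux ω hω (FF ω a u) hFC (tsupport u) hK hKS hF0 (by
    intro x hx hx0
    have h1 := flux1 ω hω u (hu2.differentiableOn (by simp)) hbc x hx hx0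
    have h2 := XX_flux ω hω x hx hx0
    rw [← ha] at h2
    simp only [FF, sub_mul, Finset.sum_sub_distrib]
    rw [h1, ← h2, Finset.sum_mul, sub_eq_zero]
    exact Finset.sum_congr rfl fun j _ => by ring)
  have hm := (cone_isOpen ω).measurableSet
  have huc : ContinuousOn u (tsupport u) := hu2.continuousOn.mono hKS
  have hGc : ∀ e, ContinuousOn (fun y => fderivWithin ℝ u (SS ω) y e) (tsupport u) := by
    intro e
    have h := (hu2.continuousOn_fderivWithin (SS_uniqueDiff ω hω) (by norm_num)).mono hKS
    exact h.clm_apply continuousOn_const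
  have hfz : ∀ x ∉ tsupport u, fderiv ℝ u x = 0 := fun x hx =>
    image_eq_zero_of_notMem_tsupport fun h => hx (tsupport_fderiv_subset ℝ h)
  have I1 : IntegrableOn (fun x => ∑ i, ‖diracOp u x i‖ ^ 2) (Cone ω) := by
    refine intOn ω _ hK _ (fun x => ∑ i, ‖((-Complex.I) •
      (alpha1.mulVec (fderivWithin ℝ u (SS ω) x (Pi.single 0 1))
      + alpha2.mulVec (fderivWithin ℝ u (SS ω) x (Pi.single 1 1))
      + alpha3.mulVec (fderivWithin ℝ u (SS ω) x (Pi.single 2 1)))) i‖ ^ 2) ?_ ?_ ?_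
    · have hmv : ∀ (M : Matrix (Fin 4) (Fin 4) ℂ) e, ContinuousOn
          (fun x => M.mulVec (fderivWithin ℝ u (SS ω) x e)) (tsupport u) := fun M e =>
        (Continuous.matrix_mulVec continuous_const continuous_id).comp_continuousOn (hGc e)
      have hs := (((hmv alpha1 (Pi.single 0 1)).add (hmv alpha2 (Pi.single 1 1))).add
        (hmv alpha3 (Pi.single 2 1))).const_smul (-Complex.I)
      exact continuousOn_finset_sum _ fun i _ => ((continuousOn_pi.1 hs i).norm.pow 2)
    · intro x hx
      simp only [diracOp, fderivWithin_of_mem_nhds (SS_nhds ω hx)]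
    · intro x _ hx
      simp [diracOp, hfz x hx]
  have I2 : IntegrableOn (fun x => ∑ j, fderiv ℝ (FF ω a u j) x (Pi.single j 1)) (Cone ω) := by
    refine intOn ω _ hK _ (fun x => ∑ j, fderivWithin ℝ (FF ω a u j) (SS ω) x (Pi.single j 1))
      ?_ ?_ ?_
    · refine continuousOn_finset_sum _ fun j _ => ?_
      exact (((hFC j).continuousOn_fderivWithin (SS_uniqueDiff ω hω) (by norm_num)).mono
        hKS).clm_apply continuousOn_const
    · intro x hx
      simp only [fderivWithin_of_mem_nhds (SS_nhds ω hx)]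
    · intro x _ hx
      refine Finset.sum_eq_zero fun j _ => ?_
      have : FF ω a u j =ᶠ[nhds x] fun _ => 0 := by
        filter_upwards [(isClosed_tsupport u).isOpen_compl.mem_nhds hx] with y hy
        exact hF0 j y hy
      rw [this.fderiv_eq]; simp
  have I3 : IntegrableOn (fun x => (∑ i, ‖u x i‖ ^ 2) / (∑ j, (x j) ^ 2)) (Cone ω) := by
    refine intOn ω _ hK _ _ ?_ (fun _ _ => rfl) ?_
    · refine ContinuousOn.div (continuousOn_finset_sum _ fun i _ =>
        ((continuousOn_pi.1 huc i).norm.pow 2)) (by fun_prop) ?_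
      intro x hx
      have := (SS_facts ω hω x (hKS hx)).1
      rw [Fin.sum_univ_three, ← rad_sq]
      positivity
    · intro x _ hx
      simp [hu0 x hx]
  have hmono := setIntegral_mono_on (I2.add (I3.const_mul ((π / (4 * ω)) ^ 2))) I1 hm
    (fun x hx => pointwise ω hω a ha u hu2 x hx)
  simp only [Pi.add_apply] at hmono
  rw [integral_add I2 (I3.const_mul _), hdz, zero_add, integral_const_mul] at hmono
  exact hmono

/-- Hardy inequality for the MIT bag Dirac operator on a convex cone (Proposition 2.6). -/
theorem hardy_inequality_mit_dirac_cone (ω : ℝ) (hω : ω ∈ Ioo 0 (π / 2))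
    (u : (Fin 3 → ℝ) → (Fin 4 → ℂ)) (hu : u ∈ MITDomain ω) :
    ∫ x in Cone ω, (∑ i, ‖diracOp u x i‖ ^ 2) ≥
      (π / (4 * ω)) ^ 2 * ∫ x in Cone ω, (∑ i, ‖u x i‖ ^ 2) / (∑ j, (x j) ^ 2) :=
  main_thm ω hω u hu

end
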